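/- arXiv:1102.3818 — 2 statements merged into one kernel-verified Lean document; each statement's English description precedes it below -/
import Mathlib

section
/- Let n ≥ 1 and let k ≥ 0 be an even integer. If f : H⁺ → Cl_n is a smooth k-hypermonogenic function, i.e. Df + k·(Qf)′/x_n = 0 on H⁺, then D(Δ^{k/2} f) = 0 on H⁺. -/
noncomputable section

open scoped symmDiff

/-- An explicit model of the real Clifford algebra `Cl_n` with generators `e 0, …, e (n-1)`
satisfying `eᵢ eⱼ + eⱼ eᵢ = -2 δᵢⱼ` (the Clifford algebra of the negative definite
quadratic form on `ℝⁿ`): elements are coordinate functions on the canonical basis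
`(e_A)_{A ⊆ {0,…,n-1}}`, where `e_A` is the (increasingly ordered) product of the `e i`, `i ∈ A`. -/
def Cl (n : ℕ) : Type := Finset (Fin n) → ℝ

namespace Cl

variable {n : ℕ}

instance : NormedAddCommGroup (Cl n) :=
  inferInstanceAs (NormedAddCommGroup (Finset (Fin n) → ℝ))

instance : NormedSpace ℝ (Cl n) :=
  inferInstanceAs (NormedSpace ℝ (Finset (Fin n) → ℝ))

/-- The coefficient of `a` at the basis element `e_A`. -/
def coeff (a : Cl n) (A : Finset (Fin n)) : ℝ := a A

/-- The sign occurring in the product `e_A * e_B = mulSign A B • e_{A ∆ B}`,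
coming from the relations `eᵢ eⱼ = -eⱼ eᵢ` (i ≠ j) and `eᵢ² = -1`. -/
def mulSign (A B : Finset (Fin n)) : ℝ :=
  (-1 : ℝ) ^ (((A ×ˢ B).filter fun p => p.2 < p.1).card + (A ∩ B).card)

/-- Clifford multiplication. -/
def mul (a b : Cl n) : Cl n := fun C =>
  ∑ A : Finset (Fin n), ∑ B : Finset (Fin n),
    if A ∆ B = C then mulSign A B * a A * b B else 0

/-- The unit `1` of the Clifford algebra. -/
def one : Cl n := Pi.single ∅ 1

/-- The embedding of the real scalars. -/
def scalar (r : ℝ) : Cl n := Pi.single ∅ r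

/-- The generators `e i` (in the paper: `e_1, …, e_n`). -/
def e (i : Fin n) : Cl n := Pi.single {i} 1

/-- Reversion: the anti-automorphism fixing all the `e i`. -/
def reverse (a : Cl n) : Cl n := fun A => (-1 : ℝ) ^ (A.card * (A.card - 1) / 2) * a A

/-- The main involution `′`: the automorphism with `(e i)′ = - e i`. -/
def involute (a : Cl n) : Cl n := fun A => (-1 : ℝ) ^ A.card * a A

/-- Clifford conjugation: the anti-automorphism with `conj (e i) = - e i`
(the composite of reversion and the main involution). -/
def conj (a : Cl n) : Cl n := fun A => (-1 : ℝ) ^ (A.card * (A.card + 1) / 2) * a A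

/-- The norm on `Cl n`: the square root of the sum of the squares of the
coordinates in the standard basis. -/
def norm (a : Cl n) : ℝ := Real.sqrt (∑ A : Finset (Fin n), a A ^ 2)

/-- Invertibility in the Clifford algebra. -/
def IsInvertible (a : Cl n) : Prop := ∃ b, mul a b = one ∧ mul b a = one

/-- The inverse of an invertible Clifford number (junk value `0` otherwise). -/
def inv (a : Cl n) : Cl n :=
  letI := Classical.propDecidable (IsInvertible a)
  if h : IsInvertible a then h.choose else 0

/-- The paravector `x₀ + x₁ e₁ + ⋯ + xₙ eₙ` attached to `x ∈ ℝ^{n+1}`. -/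
def para (x : Fin (n + 1) → ℝ) : Cl n :=
  scalar (x 0) + ∑ i : Fin n, x i.succ • e i

/-- Being a paravector. -/
def IsParavector (a : Cl n) : Prop := ∃ x : Fin (n + 1) → ℝ, a = para x

/-- The coordinates in `ℝ^{n+1}` of (the paravector part of) a Clifford number. -/
def paraCoord (a : Cl n) : Fin (n + 1) → ℝ :=
  Fin.cases (coeff a ∅) (fun i => coeff a {i})

/-- Being a (possibly empty) product of nonzero paravectors. -/
def IsProdOfParavectors (a : Cl n) : Prop :=
  ∃ l : List (Fin (n + 1) → ℝ), (∀ x ∈ l, x ≠ 0) ∧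
    a = l.foldr (fun x b => mul (para x) b) one

/-- The special Ahlfors–Vahlen group `SAV(ℝ ⊕ ℝⁿ)`: 2×2 matrices `(a b; c d)` with entries
in `Cl n` such that each entry is `0` or a product of nonzero paravectors,
`a ⬝ reverse d - b ⬝ reverse c = 1`, and `a c⁻¹, c⁻¹ d` are paravectors if `c ≠ 0`
resp. `b d⁻¹` is a paravector if `c = 0`. -/
structure SAV (n : ℕ) where
  a : Cl n
  b : Cl n
  c : Cl n
  d : Cl n
  prod_a : a = 0 ∨ IsProdOfParavectors a
  prod_b : b = 0 ∨ IsProdOfParavectors b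
  prod_c : c = 0 ∨ IsProdOfParavectors c
  prod_d : d = 0 ∨ IsProdOfParavectors d
  det : mul a (reverse d) - mul b (reverse c) = one
  cond_c : c ≠ 0 → IsParavector (mul a (inv c)) ∧ IsParavector (mul (inv c) d)
  cond_c0 : c = 0 → IsParavector (mul b (inv d))

/-- The Clifford number `c x + d` attached to a matrix `M` and `x ∈ ℝ^{n+1}`. -/
def cxd (M : SAV n) (x : Fin (n + 1) → ℝ) : Cl n := mul M.c (para x) + M.d

/-- The numerator `a x + b`. -/
def axb (M : SAV n) (x : Fin (n + 1) → ℝ) : Cl n := mul M.a (para x) + M.b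

/-- The Möbius transformation `M<x> = (ax+b)(cx+d)⁻¹` as a Clifford number. -/
def moebiusCl (M : SAV n) (x : Fin (n + 1) → ℝ) : Cl n := mul (axb M x) (inv (cxd M x))

/-- The Möbius transformation `M<x>` as a point of `ℝ^{n+1}`. -/
def moebius (M : SAV n) (x : Fin (n + 1) → ℝ) : Fin (n + 1) → ℝ :=
  paraCoord (moebiusCl M x)

/-- `a` lies in the subalgebra `Cl_{n-1}` generated by the `e j` with `j ≠ i`. -/
def memSub (a : Cl n) (i : Fin n) : Prop := ∀ A : Finset (Fin n), i ∈ A → coeff a A = 0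

/-- The subgroup `SAV(ℝ ⊕ ℝ^{m})` of `SAV(ℝ ⊕ ℝ^{m+1})` of matrices whose entries lie
in the subalgebra `Cl_m ⊆ Cl_{m+1}`. -/
structure SAVsub (m : ℕ) extends SAV (m + 1) where
  sub_a : memSub a (Fin.last m)
  sub_b : memSub b (Fin.last m)
  sub_c : memSub c (Fin.last m)
  sub_d : memSub d (Fin.last m)

/-- The `P`-part of `a ∈ Cl_{m+1} = Cl_m ⊕ Cl_m e_{top}`: `a = P a + (Q a) e_top`. -/
def Ppart {m : ℕ} (a : Cl (m + 1)) : Cl (m + 1) := fun A =>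
  if Fin.last m ∈ A then 0 else a A

/-- The `Q`-part of `a ∈ Cl_{m+1} = Cl_m ⊕ Cl_m e_{top}`: `a = P a + (Q a) e_top`. -/
def Qpart {m : ℕ} (a : Cl (m + 1)) : Cl (m + 1) := fun A =>
  if Fin.last m ∈ A then 0 else a (insert (Fin.last m) A)

/-- Partial derivative `∂f/∂xᵢ`. -/
def pderiv {E : Type*} [NormedAddCommGroup E] [NormedSpace ℝ E] {m : ℕ}
    (i : Fin m) (f : (Fin m → ℝ) → E) (x : Fin m → ℝ) : E :=
  fderiv ℝ f x (Pi.single i 1)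

/-- The Euclidean Laplacian `Δ = Σᵢ ∂²/∂xᵢ²` (acting componentwise). -/
def lap {E : Type*} [NormedAddCommGroup E] [NormedSpace ℝ E] {m : ℕ}
    (f : (Fin m → ℝ) → E) : (Fin m → ℝ) → E :=
  fun x => ∑ i : Fin m, pderiv i (pderiv i f) x

/-- The Euclidean Dirac operator `D f = ∂f/∂x₀ + Σᵢ eᵢ ∂f/∂xᵢ`. -/
def dirac (f : (Fin (n + 1) → ℝ) → Cl n) : (Fin (n + 1) → ℝ) → Cl n :=
  fun x => pderiv 0 f x + ∑ i : Fin n, mul (e i) (pderiv i.succ f x)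

/-- Upper half-space `H⁺ = {x ∈ ℝ^{n+1} : xₙ > 0}`. -/
def upperHalf (n : ℕ) : Set (Fin (n + 1) → ℝ) := {x | 0 < x (Fin.last n)}

/-- The Euclidean norm on `ℝ^m`. -/
def enorm {m : ℕ} (x : Fin m → ℝ) : ℝ := Real.sqrt (∑ i, x i ^ 2)

end Cl

namespace Cl

open scoped ContDiff

section PartialDerivatives

variable {E F : Type*} [NormedAddCommGroup E] [NormedSpace ℝ E]
  [NormedAddCommGroup F] [NormedSpace ℝ F] {d : ℕ} {U : Set (Fin d → ℝ)} {f g : (Fin d → ℝ) → E}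

theorem contDiffOn_pderiv (hU : IsOpen U) (hf : ContDiffOn ℝ ∞ f U) (i : Fin d) :
    ContDiffOn ℝ ∞ (pderiv i f) U :=
  (hf.fderiv_of_isOpen hU (by simp)).clm_apply contDiffOn_const

theorem differentiableAt_of_contDiffOn (hU : IsOpen U) (hf : ContDiffOn ℝ ∞ f U)
    {x : Fin d → ℝ} (hx : x ∈ U) : DifferentiableAt ℝ f x :=
  (hf.contDiffAt (hU.mem_nhds hx)).differentiableAt (by simp)

theorem pderiv_congr (hU : IsOpen U) (h : Set.EqOn f g U) (i : Fin d) :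
    Set.EqOn (pderiv i f) (pderiv i g) U := fun x hx => by
  simp only [pderiv, (h.eventuallyEq_of_mem (hU.mem_nhds hx)).fderiv_eq]

theorem pderiv_clm (L : E →L[ℝ] F) (i : Fin d) {x : Fin d → ℝ} (hf : DifferentiableAt ℝ f x) :
    pderiv i (fun y => L (f y)) x = L (pderiv i f x) := by
  exact congrArg (· (Pi.single i 1)) (L.hasFDerivAt.comp x hf.hasFDerivAt).fderiv

theorem pderiv_sum {ι : Type*} (s : Finset ι) (G : ι → (Fin d → ℝ) → E) (i : Fin d)
    {x : Fin d → ℝ} (hG : ∀ j ∈ s, DifferentiableAt ℝ (G j) x) :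
    pderiv i (fun y => ∑ j ∈ s, G j y) x = ∑ j ∈ s, pderiv i (G j) x := by
  simp [pderiv, fderiv_fun_sum hG]

theorem pderiv_comm (hU : IsOpen U) (hf : ContDiffOn ℝ ∞ f U) (i j : Fin d)
    {x : Fin d → ℝ} (hx : x ∈ U) : pderiv i (pderiv j f) x = pderiv j (pderiv i f) x := by
  have hd : DifferentiableAt ℝ (fderiv ℝ f) x :=
    differentiableAt_of_contDiffOn hU (hf.fderiv_of_isOpen hU (by simp)) hx
  have key (a b : Fin d) : pderiv a (pderiv b f) x =
      fderiv ℝ (fderiv ℝ f) x (Pi.single a 1) (Pi.single b 1) :=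
    congrArg (· (Pi.single a 1)) (hd.hasFDerivAt.clm_apply
      (hasFDerivAt_const (Pi.single b (1 : ℝ)) x)).fderiv |>.trans (by simp)
  rw [key, key]
  exact ((hf.contDiffAt (hU.mem_nhds hx)).isSymmSndFDerivAt (by
    rw [minSmoothness_of_isRCLikeNormedField]; exact WithTop.coe_le_coe.2 le_top)) _ _

theorem pderiv_coord_smul (i j : Fin d) {x : Fin d → ℝ} (hf : DifferentiableAt ℝ f x) :
    pderiv i (fun y => y j • f y) x =
      x j • pderiv i f x + (if i = j then f x else 0) := by
  have h : HasFDerivAt (fun y : Fin d → ℝ => y j)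
      (ContinuousLinearMap.proj (R := ℝ) (φ := fun _ : Fin d => ℝ) j) x :=
    (ContinuousLinearMap.proj (R := ℝ) (φ := fun _ : Fin d => ℝ) j).hasFDerivAt
  refine (congrArg (· (Pi.single i 1)) (h.smul hf.hasFDerivAt).fderiv).trans ?_
  by_cases hij : i = j
  · simp [hij, pderiv]
  · simp [hij, pderiv, Ne.symm hij]

theorem contDiffOn_lap (hU : IsOpen U) (hf : ContDiffOn ℝ ∞ f U) :
    ContDiffOn ℝ ∞ (lap f) U :=
  ContDiffOn.sum fun i _ => contDiffOn_pderiv hU (contDiffOn_pderiv hU hf i) i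

theorem contDiffOn_lap_iterate (hU : IsOpen U) (hf : ContDiffOn ℝ ∞ f U) (l : ℕ) :
    ContDiffOn ℝ ∞ (lap^[l] f) U := by
  induction l with
  | zero => exact hf
  | succ l ih => rw [Function.iterate_succ_apply']; exact contDiffOn_lap hU ih

theorem lap_congr (hU : IsOpen U) (h : Set.EqOn f g U) : Set.EqOn (lap f) (lap g) U :=
  fun _ hx => Finset.sum_congr rfl fun i _ => pderiv_congr hU (pderiv_congr hU h i) i hx

theorem lap_iterate_congr (hU : IsOpen U) (h : Set.EqOn f g U) (l : ℕ) :
    Set.EqOn (lap^[l] f) (lap^[l] g) U := by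
  induction l with
  | zero => exact h
  | succ l ih => simp only [Function.iterate_succ_apply']; exact lap_congr hU ih

theorem pderiv_pderiv_clm (hU : IsOpen U) (hf : ContDiffOn ℝ ∞ f U) (L : E →L[ℝ] F)
    (i j : Fin d) {x : Fin d → ℝ} (hx : x ∈ U) :
    pderiv i (pderiv j fun y => L (f y)) x = L (pderiv i (pderiv j f) x) := by
  rw [pderiv_congr hU (fun y hy => pderiv_clm L j (differentiableAt_of_contDiffOn hU hf hy)) i hx,
    pderiv_clm L i (differentiableAt_of_contDiffOn hU (contDiffOn_pderiv hU hf j) hx)]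

theorem lap_clm (hU : IsOpen U) (hf : ContDiffOn ℝ ∞ f U) (L : E →L[ℝ] F) :
    Set.EqOn (lap fun y => L (f y)) (fun y => L (lap f y)) U := fun x hx => by
  simp only [lap, map_sum, pderiv_pderiv_clm hU hf L _ _ hx]

theorem lap_iterate_clm (hU : IsOpen U) (hf : ContDiffOn ℝ ∞ f U) (L : E →L[ℝ] F) (l : ℕ) :
    Set.EqOn (lap^[l] fun y => L (f y)) (fun y => L (lap^[l] f y)) U := by
  induction l with
  | zero => exact fun _ _ => rfl
  | succ l ih =>
    simp only [Function.iterate_succ_apply']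
    exact (lap_congr hU ih).trans (lap_clm hU (contDiffOn_lap_iterate hU hf l) L)

theorem lap_sum (hU : IsOpen U) {ι : Type*} (s : Finset ι) (G : ι → (Fin d → ℝ) → E)
    (hG : ∀ j ∈ s, ContDiffOn ℝ ∞ (G j) U) :
    Set.EqOn (lap fun y => ∑ j ∈ s, G j y) (fun y => ∑ j ∈ s, lap (G j) y) U := fun x hx => by
  simp only [lap]
  rw [Finset.sum_comm]
  refine Finset.sum_congr rfl fun i _ => ?_
  rw [pderiv_congr hU (fun y hy => pderiv_sum s G i fun j hj =>
      differentiableAt_of_contDiffOn hU (hG j hj) hy) i hx,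
    pderiv_sum s _ i fun j hj =>
      differentiableAt_of_contDiffOn hU (contDiffOn_pderiv hU (hG j hj) i) hx]

theorem lap_pderiv (hU : IsOpen U) (hf : ContDiffOn ℝ ∞ f U) (j : Fin d) :
    Set.EqOn (lap (pderiv j f)) (pderiv j (lap f)) U := fun x hx => by
  have h2 (i : Fin d) := contDiffOn_pderiv hU (contDiffOn_pderiv hU hf i) i
  have hs : pderiv j (lap f) x = ∑ i, pderiv j (pderiv i (pderiv i f)) x :=
    pderiv_sum _ _ j fun i _ => differentiableAt_of_contDiffOn hU (h2 i) hx
  rw [hs]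
  refine Finset.sum_congr rfl fun i _ => ?_
  rw [pderiv_congr hU (fun y hy => pderiv_comm hU hf i j hy) i hx,
    pderiv_comm hU (contDiffOn_pderiv hU hf i) i j hx]

theorem lap_coord_smul (hU : IsOpen U) (hf : ContDiffOn ℝ ∞ f U) (j : Fin d) {x : Fin d → ℝ}
    (hx : x ∈ U) :
    lap (fun y => y j • f y) x = x j • lap f x + (2 : ℝ) • pderiv j f x := by
  have hfd {y} (hy : y ∈ U) := differentiableAt_of_contDiffOn hU hf hy
  have key (i : Fin d) : pderiv i (pderiv i fun y => y j • f y) x =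
      x j • pderiv i (pderiv i f) x + (if i = j then (2 : ℝ) • pderiv j f x else 0) := by
    have hd := differentiableAt_of_contDiffOn hU (contDiffOn_pderiv hU hf i) hx
    have hc : DifferentiableAt ℝ (fun y : Fin d → ℝ => y j) x := by fun_prop
    rw [pderiv_congr hU (fun y hy => pderiv_coord_smul i j (hfd hy)) i hx]
    by_cases hij : i = j
    · subst hij
      have : pderiv i (fun y => y i • pderiv i f y + f y) x =
          pderiv i (fun y => y i • pderiv i f y) x + pderiv i f x :=
        congrArg (· (Pi.single i 1)) (fderiv_fun_add (hc.fun_smul hd) (hfd hx))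
      simp only [if_true, this, pderiv_coord_smul i i hd]
      module
    · simp only [hij, if_false, add_zero, pderiv_coord_smul i j hd]
  simp only [lap, key, Finset.sum_add_distrib, Finset.smul_sum]
  simp

theorem isOpen_setOf_coord_pos (j : Fin d) : IsOpen {x : Fin d → ℝ | 0 < x j} :=
  isOpen_lt continuous_const (continuous_apply j)

theorem contDiffOn_coord_inv_smul (j : Fin d) (hf : ContDiffOn ℝ ∞ f {x | 0 < x j}) :
    ContDiffOn ℝ ∞ (fun x => (x j)⁻¹ • f x) {x | 0 < x j} :=
  ((contDiff_apply ℝ ℝ j).contDiffOn.inv fun _ hx => ne_of_gt hx).smul hf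

/-- Solutions of the Weinstein equation `y Δw = 2 l ∂w/∂y` on a half-space are polyharmonic. -/
theorem lap_iterate_eq_zero_of_weinstein (j : Fin d) (l : ℕ) (w : (Fin d → ℝ) → E)
    (hw : ContDiffOn ℝ ∞ w {x | 0 < x j})
    (h : ∀ x : Fin d → ℝ, 0 < x j → x j • lap w x = (2 * l : ℝ) • pderiv j w x) :
    Set.EqOn (lap^[l + 1] w) 0 {x | 0 < x j} := by
  have hU := isOpen_setOf_coord_pos j
  induction l generalizing w with
  | zero =>
    intro x hx
    simpa [(show (0 : ℝ) < x j from hx).ne'] using h x hx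
  | succ l ih =>
    set z : (Fin d → ℝ) → E := fun x => (x j)⁻¹ • pderiv j w x with hz
    have hzs : ContDiffOn ℝ ∞ z {x | 0 < x j} :=
      contDiffOn_coord_inv_smul j (contDiffOn_pderiv hU hw j)
    have hyz : Set.EqOn (pderiv j w) (fun x => x j • z x) {x | 0 < x j} := fun x hx => by
      simp [hz, smul_smul, (show (0 : ℝ) < x j from hx).ne']
    let S : E →L[ℝ] E := (2 * (l + 1 : ℕ) : ℝ) • ContinuousLinearMap.id ℝ E
    have hlap : Set.EqOn (lap w) (fun x => S (z x)) {x | 0 < x j} := fun x hx => by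
      have hx' : x j ≠ 0 := (show (0 : ℝ) < x j from hx).ne'
      apply smul_right_injective E hx'
      simp only [h x hx, hyz hx, S, smul_apply, ContinuousLinearMap.id_apply]
      rw [smul_comm]
    have hlz : ∀ x : Fin d → ℝ, 0 < x j → x j • lap z x = (2 * l : ℝ) • pderiv j z x := by
      intro x hx
      have h1 := lap_coord_smul hU hzs j hx
      rw [← lap_congr hU hyz hx, lap_pderiv hU hw j hx, pderiv_congr hU hlap j hx,
        pderiv_clm S j (differentiableAt_of_contDiffOn hU hzs hx)] at h1
      rw [← sub_eq_iff_eq_add] at h1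
      rw [← h1]
      simp only [S, smul_apply, ContinuousLinearMap.id_apply]
      push_cast
      module
    intro x hx
    rw [Function.iterate_succ_apply, lap_iterate_congr hU hlap (l + 1) hx,
      lap_iterate_clm hU hzs S (l + 1) hx]
    simp [ih z hzs hlz hx]

end PartialDerivatives

section Algebra

variable {n : ℕ}

instance : FiniteDimensional ℝ (Cl n) :=
  inferInstanceAs (FiniteDimensional ℝ (Finset (Fin n) → ℝ))

/-- The sign in `e i * e_A = leftSign i A • e_{{i} ∆ A}`, written as a product over `A`. -/
def leftSign (i : Fin n) (A : Finset (Fin n)) : ℝ := ∏ b ∈ A, if b ≤ i then -1 else 1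

theorem mulSign_singleton (i : Fin n) (A : Finset (Fin n)) :
    mulSign {i} A = leftSign i A := by
  have h1 : (({i} ×ˢ A).filter fun p : Fin n × Fin n => p.2 < p.1).card =
      (A.filter (· < i)).card := by
    rw [Finset.singleton_product, Finset.filter_map, Finset.card_map]
    rfl
  have h2 : (A.filter (· < i)).card + ({i} ∩ A).card = (A.filter (· ≤ i)).card := by
    rw [← Finset.card_union_of_disjoint]
    · congr 1
      ext b
      simp only [Finset.mem_union, Finset.mem_filter, Finset.mem_inter, Finset.mem_singleton,
        le_iff_lt_or_eq]
      grind
    · rw [Finset.disjoint_left]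
      simp only [Finset.mem_filter, Finset.mem_inter, Finset.mem_singleton]
      grind
  rw [mulSign, h1, h2, leftSign, Finset.prod_ite]
  simp

theorem leftSign_mul_self (i : Fin n) (A : Finset (Fin n)) : leftSign i A * leftSign i A = 1 := by
  rw [leftSign, ← Finset.prod_mul_distrib]
  exact Finset.prod_eq_one fun b _ => by split_ifs <;> norm_num

theorem leftSign_symmDiff (i j : Fin n) (A : Finset (Fin n)) :
    leftSign j (A ∆ {i}) = (if i ≤ j then -1 else 1) * leftSign j A := by
  by_cases h : i ∈ A
  · have : A ∆ {i} = A.erase i := by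
      ext b; simp only [Finset.mem_symmDiff, Finset.mem_singleton, Finset.mem_erase]; grind
    rw [this, leftSign, leftSign, ← Finset.mul_prod_erase A _ h, ← mul_assoc]
    split_ifs <;> simp
  · have : A ∆ {i} = insert i A := by
      ext b; simp only [Finset.mem_symmDiff, Finset.mem_singleton, Finset.mem_insert]; grind
    rw [this, leftSign, Finset.prod_insert h, leftSign]

theorem mul_e_apply (i : Fin n) (b : Cl n) (C : Finset (Fin n)) :
    mul (e i) b C = leftSign i (C ∆ {i}) * b (C ∆ {i}) := by
  have hB (B : Finset (Fin n)) : {i} ∆ B = C ↔ C ∆ {i} = B := by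
    constructor <;> rintro rfl <;> simp [symmDiff_comm {i}]
  rw [mul, Finset.sum_eq_single {i}]
  · simp [hB, e, mulSign_singleton]
  · intro A _ hA
    simp [e, Pi.single_eq_of_ne hA]
  · simp

/-- Left multiplication by `e i`. -/
def eMulLeft (i : Fin n) : Cl n →L[ℝ] Cl n :=
  LinearMap.toContinuousLinearMap
    { toFun := mul (e i)
      map_add' := fun a b => funext fun C => by
        change _ = mul (e i) a C + mul (e i) b C
        simp only [mul_e_apply]
        exact mul_add _ _ _
      map_smul' := fun r a => funext fun C => by
        change _ = r * mul (e i) a C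
        simp only [mul_e_apply]
        exact mul_left_comm _ _ _ }

theorem eMulLeft_apply (i : Fin n) (a : Cl n) : eMulLeft i a = mul (e i) a := rfl

theorem eMulLeft_eMulLeft_self (i : Fin n) (a : Cl n) : eMulLeft i (eMulLeft i a) = -a := by
  funext C
  change mul (e i) (mul (e i) a) C = -(a C)
  simp only [mul_e_apply, leftSign_symmDiff, symmDiff_symmDiff_cancel_right, le_refl, if_true]
  linear_combination (-a C) * leftSign_mul_self i C

theorem eMulLeft_anticomm {i j : Fin n} (hij : i ≠ j) (a : Cl n) :
    eMulLeft i (eMulLeft j a) + eMulLeft j (eMulLeft i a) = 0 := by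
  funext C
  change mul (e i) (mul (e j) a) C + mul (e j) (mul (e i) a) C = 0
  simp only [mul_e_apply, leftSign_symmDiff, le_refl, if_true, symmDiff_right_comm C {j} {i}]
  rcases lt_or_gt_of_ne hij with h | h
  · simp only [h.le, not_le.2 h, if_true, if_false]; ring
  · simp only [h.le, not_le.2 h, if_true, if_false]; ring

/-- The main involution as a continuous linear map. -/
def involuteL : Cl n →L[ℝ] Cl n :=
  LinearMap.toContinuousLinearMap
    { toFun := involute
      map_add' := fun _ _ => funext fun _ => mul_add _ _ _
      map_smul' := fun _ _ => funext fun _ => mul_left_comm _ _ _ }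

theorem involuteL_apply (a : Cl n) : involuteL a = involute a := rfl

/-- The `Q`-part as a continuous linear map. -/
def QpartL {m : ℕ} : Cl (m + 1) →L[ℝ] Cl (m + 1) :=
  LinearMap.toContinuousLinearMap
    { toFun := Qpart
      map_add' := fun a b => funext fun C => by
        change _ = Qpart a C + Qpart b C
        simp only [Qpart]
        split_ifs
        · simp
        · rfl
      map_smul' := fun r a => funext fun C => by
        change _ = r * Qpart a C
        simp only [Qpart]
        split_ifs
        · simp
        · rfl }

theorem QpartL_apply {m : ℕ} (a : Cl (m + 1)) : QpartL a = Qpart a := rfl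

theorem Qpart_involute_Qpart {m : ℕ} (a : Cl (m + 1)) :
    Qpart (involute (Qpart a)) = 0 := by
  funext C
  change Qpart (involute (Qpart a)) C = 0
  simp [Qpart, involute]

theorem Qpart_mul_e_castSucc {m : ℕ} (i : Fin m) (a : Cl (m + 1)) :
    Qpart (mul (e i.castSucc) (involute (Qpart a))) = 0 := by
  funext C
  change Qpart (mul (e i.castSucc) (involute (Qpart a))) C = 0
  have : Fin.last m ∈ insert (Fin.last m) C ∆ {i.castSucc} := by
    simp [Finset.mem_symmDiff, (Fin.castSucc_lt_last i).ne']
  simp [Qpart, mul_e_apply, involute, this]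

theorem leftSign_last {m : ℕ} (A : Finset (Fin (m + 1))) :
    leftSign (Fin.last m) A = (-1) ^ A.card := by
  simp [leftSign, Fin.le_last]

theorem Qpart_mul_e_last {m : ℕ} (a : Cl (m + 1)) :
    Qpart (mul (e (Fin.last m)) (involute (Qpart a))) = Qpart a := by
  funext C
  by_cases h : Fin.last m ∈ C
  · simp [Qpart, h]
  · have : insert (Fin.last m) C ∆ {Fin.last m} = C := by
      ext b; simp only [Finset.mem_symmDiff, Finset.mem_singleton, Finset.mem_insert]; grind
    simp only [Qpart, mul_e_apply, this, h, if_false, leftSign_last, involute]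
    rw [← mul_assoc, ← mul_pow]
    simp

end Algebra

section Dirac

variable {n : ℕ} {U : Set (Fin (n + 1) → ℝ)} {f : (Fin (n + 1) → ℝ) → Cl n}

/-- The coefficients `1, e 0, …, e (n-1)` of the Dirac operator, as left multiplications. -/
def diracCoeff : Fin (n + 1) → (Cl n →L[ℝ] Cl n) :=
  Fin.cases (ContinuousLinearMap.id ℝ _) eMulLeft

/-- The coefficients `1, -e 0, …, -e (n-1)` of the conjugate Dirac operator. -/
def conjDiracCoeff : Fin (n + 1) → (Cl n →L[ℝ] Cl n) :=
  Fin.cases (ContinuousLinearMap.id ℝ _) fun i => -eMulLeft i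

theorem dirac_eq_sum (f : (Fin (n + 1) → ℝ) → Cl n) :
    dirac f = fun x => ∑ i, diracCoeff i (pderiv i f x) := by
  funext x
  simp [dirac, Fin.sum_univ_succ, diracCoeff, eMulLeft_apply]

theorem conjDiracCoeff_diracCoeff (i j : Fin (n + 1)) (a : Cl n) :
    conjDiracCoeff i (diracCoeff j a) + conjDiracCoeff j (diracCoeff i a) =
      if i = j then (2 : ℝ) • a else 0 := by
  cases i using Fin.cases with
  | zero =>
    cases j using Fin.cases with
    | zero => simp [conjDiracCoeff, diracCoeff, two_smul]
    | succ j => simp [conjDiracCoeff, diracCoeff, (Fin.succ_ne_zero j).symm]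
  | succ i =>
    cases j using Fin.cases with
    | zero => simp [conjDiracCoeff, diracCoeff]
    | succ j =>
      by_cases hij : i = j
      · subst hij
        simp [conjDiracCoeff, diracCoeff, eMulLeft_eMulLeft_self, two_smul]
      · simp only [conjDiracCoeff, diracCoeff, Fin.cases_succ, Fin.succ_inj, hij, if_false,
          neg_apply]
        rw [← neg_add, eMulLeft_anticomm hij, neg_zero]

theorem contDiffOn_diracCoeff_pderiv (hU : IsOpen U) (hf : ContDiffOn ℝ ∞ f U)
    (i : Fin (n + 1)) : ContDiffOn ℝ ∞ (fun x => diracCoeff i (pderiv i f x)) U :=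
  (diracCoeff i).contDiff.comp_contDiffOn (contDiffOn_pderiv hU hf i)

theorem lap_dirac (hU : IsOpen U) (hf : ContDiffOn ℝ ∞ f U) :
    Set.EqOn (lap (dirac f)) (dirac (lap f)) U := fun x hx => by
  simp only [dirac_eq_sum]
  rw [lap_sum hU _ _ (fun i _ => contDiffOn_diracCoeff_pderiv hU hf i) hx]
  refine Finset.sum_congr rfl fun i _ => ?_
  rw [lap_clm hU (contDiffOn_pderiv hU hf i) _ hx]
  simp only [lap_pderiv hU hf i hx]

theorem lap_iterate_dirac (hU : IsOpen U) (hf : ContDiffOn ℝ ∞ f U) (l : ℕ) :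
    Set.EqOn (lap^[l] (dirac f)) (dirac (lap^[l] f)) U := by
  induction l with
  | zero => exact fun _ _ => rfl
  | succ l ih =>
    simp only [Function.iterate_succ_apply']
    exact (lap_congr hU ih).trans (lap_dirac hU (contDiffOn_lap_iterate hU hf l))

/-- The conjugate Dirac operator composed with the Dirac operator is the Laplacian. -/
theorem sum_conjDiracCoeff_pderiv_dirac (hU : IsOpen U) (hf : ContDiffOn ℝ ∞ f U)
    {x : Fin (n + 1) → ℝ} (hx : x ∈ U) :
    ∑ i, conjDiracCoeff i (pderiv i (dirac f) x) = lap f x := by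
  have h1 (i : Fin (n + 1)) : pderiv i (dirac f) x =
      ∑ j, diracCoeff j (pderiv i (pderiv j f) x) := by
    rw [dirac_eq_sum, pderiv_sum _ _ i fun j _ =>
      differentiableAt_of_contDiffOn hU (contDiffOn_diracCoeff_pderiv hU hf j) hx]
    exact Finset.sum_congr rfl fun j _ => pderiv_clm _ i
      (differentiableAt_of_contDiffOn hU (contDiffOn_pderiv hU hf j) hx)
  simp only [h1, map_sum]
  set T := ∑ i, ∑ j, conjDiracCoeff i (diracCoeff j (pderiv i (pderiv j f) x)) with hT
  have hT' : T = ∑ i, ∑ j, conjDiracCoeff j (diracCoeff i (pderiv i (pderiv j f) x)) := by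
    rw [hT, Finset.sum_comm]
    simp only [pderiv_comm hU hf _ _ hx]
  have h2 : (2 : ℝ) • T = (2 : ℝ) • lap f x := by
    conv_lhs => rw [two_smul]
    nth_rewrite 2 [hT']
    rw [hT]
    simp only [← Finset.sum_add_distrib, conjDiracCoeff_diracCoeff, Finset.sum_ite_eq,
      Finset.mem_univ, if_true, lap, Finset.smul_sum]
  exact smul_right_injective _ (two_ne_zero' ℝ) h2

/-- Only the last coefficient of the conjugate Dirac operator contributes to the `Q`-part. -/
theorem Qpart_sum_conjDiracCoeff_involute_Qpart {m : ℕ} (v : Fin (m + 2) → Cl (m + 1)) :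
    QpartL (∑ i, conjDiracCoeff i (involuteL (QpartL (v i)))) =
      -QpartL (v (Fin.last (m + 1))) := by
  rw [map_sum, Fin.sum_univ_succ, Fin.sum_univ_castSucc]
  simp only [conjDiracCoeff, ← Fin.succ_last, Fin.cases_succ, Fin.cases_zero, neg_apply, map_neg]
  simp [involuteL_apply, QpartL_apply, eMulLeft_apply, Qpart_involute_Qpart,
    Qpart_mul_e_castSucc, Qpart_mul_e_last]

end Dirac

end Cl

open Cl in
theorem kHypermonogenic_is_kHolomorphicCliffordian
    (m : ℕ) (k : ℕ) (hk : Even k)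
    (f : (Fin (m + 2) → ℝ) → Cl (m + 1))
    (hf : ContDiffOn ℝ (⊤ : ℕ∞) f (Cl.upperHalf (m + 1)))
    (hmono : ∀ x ∈ Cl.upperHalf (m + 1),
      Cl.dirac f x + ((k : ℝ) / x (Fin.last (m + 1))) •
        Cl.involute (Cl.Qpart (f x)) = 0) :
    ∀ x ∈ Cl.upperHalf (m + 1), Cl.dirac ((Cl.lap)^[k / 2] f) x = 0 := by
  have hU : IsOpen (Cl.upperHalf (m + 1)) := isOpen_setOf_coord_pos _
  set j := Fin.last (m + 1)
  set u : (Fin (m + 2) → ℝ) → Cl (m + 1) := fun x => (x j)⁻¹ • f x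
  have hus : ContDiffOn ℝ (⊤ : ℕ∞) u (Cl.upperHalf (m + 1)) := contDiffOn_coord_inv_smul j hf
  set w : (Fin (m + 2) → ℝ) → Cl (m + 1) := fun x => QpartL (u x)
  have hws : ContDiffOn ℝ (⊤ : ℕ∞) w (Cl.upperHalf (m + 1)) :=
    QpartL.contDiff.comp_contDiffOn hus
  let R : Cl (m + 1) →L[ℝ] Cl (m + 1) := -(k : ℝ) • involuteL
  have hdirac : Set.EqOn (dirac f) (fun x => R (w x)) (Cl.upperHalf (m + 1)) := fun x hx => by
    rw [eq_neg_of_add_eq_zero_left (hmono x hx), ← QpartL_apply, ← involuteL_apply]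
    simp [R, w, u, smul_smul, div_eq_mul_inv, mul_comm]
  have hQf : Set.EqOn (fun x => QpartL (f x)) (fun x => x j • w x) (Cl.upperHalf (m + 1)) :=
    fun x hx => by
      simp [w, u, smul_smul, (show (0 : ℝ) < x j from hx).ne']
  have hlap (x) (hx : x ∈ Cl.upperHalf (m + 1)) :
      x j • lap w x + (2 : ℝ) • pderiv j w x = (k : ℝ) • pderiv j w x := by
    have hpw (i : Fin (m + 2)) : pderiv i w x = QpartL (pderiv i u x) :=
      pderiv_clm QpartL i (differentiableAt_of_contDiffOn hU hus hx)
    have hpd (i : Fin (m + 2)) : pderiv i (dirac f) x =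
        involuteL (QpartL (-(k : ℝ) • pderiv i u x)) := by
      rw [pderiv_congr hU hdirac i hx,
        pderiv_clm R i (differentiableAt_of_contDiffOn hU hws hx), hpw]
      simp [R]
    rw [← lap_coord_smul hU hws j hx, ← lap_congr hU hQf hx, lap_clm hU hf QpartL hx]
    simp only [← sum_conjDiracCoeff_pderiv_dirac hU hf hx, hpd]
    rw [Qpart_sum_conjDiracCoeff_involute_Qpart, hpw]
    simp [j]
  intro x hx
  rw [← lap_iterate_dirac hU hf _ hx, lap_iterate_congr hU hdirac _ hx,
    lap_iterate_clm hU hws R _ hx]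
  obtain ⟨l, rfl⟩ := hk
  rcases l with _ | l
  · simp [R]
  · have hl : (l + 1 + (l + 1)) / 2 = l + 1 := by omega
    have h0 : lap^[l + 1] w x = 0 := by
      refine lap_iterate_eq_zero_of_weinstein j l w hws (fun y hy => ?_) hx
      rw [← sub_eq_of_eq_add (hlap y hy).symm]
      push_cast
      module
    simp only [hl, h0, map_zero]
end
end

section
/- Let k be an even integer and let u : H⁺ → ℝ be a smooth solution of the homogeneous Weinstein equation Δu − (k/x_n) ∂u/∂x_n = 0 on H⁺. Then v(x) := x_n^{−k} u(x) satisfies Δv + (k/x_n) ∂v/∂x_n = (k/x_n²) v on H⁺, i.e. v is a solution of the inhomogeneous Weinstein equation with parameter −k. -/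
noncomputable section

open scoped symmDiff

/-- Product rule for a partial derivative of an integer power of a coordinate times a function. -/
theorem pderiv_zpow_mul {d : ℕ} (i l : Fin d) (m : ℤ) {f : (Fin d → ℝ) → ℝ} {x : Fin d → ℝ}
    (hx : x l ≠ 0) (hf : DifferentiableAt ℝ f x) :
    Cl.pderiv i (fun y => y l ^ m * f y) x =
      x l ^ m * Cl.pderiv i f x
        + (Pi.single i 1 : Fin d → ℝ) l * m * (x l ^ (m - 1) * f x) := by
  have h₁ : HasFDerivAt (fun y : Fin d → ℝ => y l ^ m)
      (((m : ℝ) * x l ^ (m - 1)) • ContinuousLinearMap.proj (R := ℝ) (φ := fun _ => ℝ) l) x :=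
    HasDerivAt.comp_hasFDerivAt (f := fun y : Fin d → ℝ => y l) x
      (hasDerivAt_zpow m (x l) (Or.inl hx)) (hasFDerivAt_apply l x)
  simp only [Cl.pderiv, (h₁.fun_mul hf.hasFDerivAt).fderiv]
  simp
  ring

/-- Product rule for a second partial derivative of an integer power of a coordinate times a
function. -/
theorem pderiv_pderiv_zpow_mul {d : ℕ} (i l : Fin d) (m : ℤ) {f : (Fin d → ℝ) → ℝ}
    {x : Fin d → ℝ} (hx : x l ≠ 0) (hf : ContDiffAt ℝ 2 f x) :
    Cl.pderiv i (Cl.pderiv i (fun y => y l ^ m * f y)) x =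
      x l ^ m * Cl.pderiv i (Cl.pderiv i f) x
        + (Pi.single i 1 : Fin d → ℝ) l * (2 * m * x l ^ (m - 1) * Cl.pderiv i f x)
        + (Pi.single i 1 : Fin d → ℝ) l ^ 2 * (m * (m - 1) * x l ^ (m - 2) * f x) := by
  have hfd : DifferentiableAt ℝ f x := hf.differentiableAt (by norm_num)
  have hpd : DifferentiableAt ℝ (Cl.pderiv i f) x :=
    ((hf.fderiv_right (m := 1) (by norm_num)).differentiableAt (by norm_num)).clm_apply
      (differentiableAt_const _)
  have hpow (p : ℤ) : DifferentiableAt ℝ (fun y : Fin d → ℝ => y l ^ p) x :=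
    (differentiableAt_apply l x).zpow (Or.inl hx)
  have hev : Cl.pderiv i (fun y => y l ^ m * f y) =ᶠ[nhds x] fun y =>
      y l ^ m * Cl.pderiv i f y
        + (Pi.single i 1 : Fin d → ℝ) l * m * (y l ^ (m - 1) * f y) := by
    have hne : ∀ᶠ y in nhds x, y l ≠ 0 := (continuous_apply l).continuousAt.eventually_ne hx
    filter_upwards [hne, hf.eventually (by simp)] with y hy hfy
    exact pderiv_zpow_mul i l m hy (hfy.differentiableAt (by norm_num))
  have hsum : Cl.pderiv i (Cl.pderiv i (fun y => y l ^ m * f y)) x =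
      Cl.pderiv i (fun y => y l ^ m * Cl.pderiv i f y) x
        + (Pi.single i 1 : Fin d → ℝ) l * m * Cl.pderiv i (fun y => y l ^ (m - 1) * f y) x := by
    conv_lhs => rw [Cl.pderiv, hev.fderiv_eq]
    rw [fderiv_fun_add ((hpow m).fun_mul hpd) (((hpow (m - 1)).fun_mul hfd).const_mul _),
      fderiv_const_mul ((hpow (m - 1)).fun_mul hfd)]
    rfl
  rw [hsum, pderiv_zpow_mul i l m hx hpd, pderiv_zpow_mul i l (m - 1) hx hfd,
    show m - 1 - 1 = m - 2 by ring]
  push_cast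
  ring

/-- The Laplacian of an integer power of a coordinate times a function. -/
theorem lap_zpow_mul {d : ℕ} (l : Fin d) (m : ℤ) {f : (Fin d → ℝ) → ℝ}
    {x : Fin d → ℝ} (hx : x l ≠ 0) (hf : ContDiffAt ℝ 2 f x) :
    Cl.lap (fun y => y l ^ m * f y) x =
      x l ^ m * Cl.lap f x + 2 * m * x l ^ (m - 1) * Cl.pderiv l f x
        + m * (m - 1) * x l ^ (m - 2) * f x := by
  simp only [Cl.lap, pderiv_pderiv_zpow_mul _ l m hx hf, Finset.sum_add_distrib,
    ← Finset.mul_sum, Pi.single_apply, ite_pow, ite_mul]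
  simp

/-- If `u` solves the homogeneous Weinstein equation `Δu - (k/xₙ) ∂u/∂xₙ = 0` on `H⁺`, then
`v = xₙ^{-k} u` solves `Δv + (k/xₙ) ∂v/∂xₙ = (k/xₙ²) v`, the inhomogeneous Weinstein
equation with parameter `-k`. -/
theorem homogeneous_weinstein_to_inhomogeneous
    (n : ℕ) (k : ℤ) (hk : Even k)
    (u : (Fin (n + 1) → ℝ) → ℝ)
    (hu : ContDiffOn ℝ (⊤ : ℕ∞) u (Cl.upperHalf n))
    (heq : ∀ x ∈ Cl.upperHalf n,
      Cl.lap u x - ((k : ℝ) / x (Fin.last n)) * Cl.pderiv (Fin.last n) u x = 0)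
    (v : (Fin (n + 1) → ℝ) → ℝ)
    (hv : v = fun y => y (Fin.last n) ^ (-k) * u y) :
    ∀ x ∈ Cl.upperHalf n,
      Cl.lap v x + ((k : ℝ) / x (Fin.last n)) * Cl.pderiv (Fin.last n) v x =
        ((k : ℝ) / x (Fin.last n) ^ 2) * v x := by
  intro x hx
  have hpos : 0 < x (Fin.last n) := hx
  have hne : x (Fin.last n) ≠ 0 := hpos.ne'
  have hopen : IsOpen (Cl.upperHalf n) :=
    isOpen_lt continuous_const (continuous_apply (Fin.last n))
  have hf : ContDiffAt ℝ 2 u x :=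
    (hu.contDiffAt (hopen.mem_nhds hx)).of_le (WithTop.coe_le_coe.mpr le_top)
  have hlap := sub_eq_zero.mp (heq x hx)
  subst hv
  rw [lap_zpow_mul _ _ hne hf, hlap,
    pderiv_zpow_mul _ _ _ hne (hf.differentiableAt (by norm_num)),
    zpow_sub₀ hne, zpow_sub₀ hne]
  simp only [Pi.single_eq_same, zpow_ofNat]
  push_cast
  field_simp
  ring
end
end
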